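/- (Multiple q-Chu–Vandermonde sum I, Proposition 6.3 of the paper) For all compositions u, w ∈ ℕ^n, Σ_v ⟦u, v⟧(a, b) ⟦v, w⟧(1, a) = ⟦u, w⟧(1, b), where the sum is over all compositions v ∈ ℕ^n (it is finitely supported, on |w| ≤ |v| ≤ |u|). -/

import Mathlib

open scoped BigOperators
open MvPolynomial

noncomputable section
namespace LRW

variable {n : ℕ}

/-- `|u|`, the weight of a composition `u ∈ ℕⁿ`. -/
def wt (u : Fin n → ℕ) : ℕ := ∑ i, u i

/-- `l'_u(i) = #{k > i : u_k > u_i} + #{k < i : u_k ≥ u_i}`. -/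
def lp (u : Fin n → ℕ) (i : Fin n) : ℕ :=
  (Finset.univ.filter fun k => i < k ∧ u i < u k).card +
  (Finset.univ.filter fun k => k < i ∧ u i ≤ u k).card

/-- The spectral vector `⟨u⟩ : ⟨u⟩_i = q^{u_i} t^{n−1−l'_u(i)}`. -/
def spec (q t : ℂ) (u : Fin n → ℕ) : Fin n → ℂ :=
  fun i => q ^ u i * t ^ (n - 1 - lp u i)

/-- Leg length `l(s)` of the cell `s = (i, j+1)` of `u` (so `j` ranges over
`0, …, u_i − 1`): `l(s) = #{k > i : j+1 ≤ u_k ≤ u_i} + #{k < i : j+1 ≤ u_k + 1 ≤ u_i}`. -/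
def leg (u : Fin n → ℕ) (i : Fin n) (j : ℕ) : ℕ :=
  (Finset.univ.filter fun k => i < k ∧ j < u k ∧ u k ≤ u i).card +
  (Finset.univ.filter fun k => k < i ∧ j ≤ u k ∧ u k < u i).card

/-- `n(u) = Σ_{s ∈ u} l(s)`. -/
def nstat (u : Fin n → ℕ) : ℕ := ∑ i, ∑ j ∈ Finset.range (u i), leg u i j

/-- `n'(u) = Σ_i C(u_i, 2)`. -/
def nstat' (u : Fin n → ℕ) : ℕ := ∑ i, Nat.choose (u i) 2

/-- `n(u⁺) = Σ_{i<j} min(u_i, u_j)`, the statistic `n` of the decreasing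
rearrangement of `u`. -/
def nplus (u : Fin n → ℕ) : ℕ := ∑ i, ∑ j, if i < j then min (u i) (u j) else 0

/-- `τ_u = (−1)^{|u|} q^{n'(u)} t^{−n(u⁺)}`. -/
def tau (q t : ℂ) (u : Fin n → ℕ) : ℂ := (-1) ^ wt u * q ^ nstat' u / t ^ nplus u

/-- The generalized q-shifted factorial `(z)_u = ∏_{s ∈ u} (1 − z q^{a'(s)} t^{−l'(s)})`. -/
def qfac (q t z : ℂ) (u : Fin n → ℕ) : ℂ :=
  ∏ i, ∏ j ∈ Finset.range (u i), (1 - z * q ^ j / t ^ lp u i)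

/-- `c'_u = ∏_{s ∈ u} (1 − q^{a(s)+1} t^{l(s)})`. -/
def cp (q t : ℂ) (u : Fin n → ℕ) : ℂ :=
  ∏ i, ∏ j ∈ Finset.range (u i), (1 - q ^ (u i - j) * t ^ leg u i j)

/-- `M` is a family of interpolation Macdonald polynomials: `M u` has total degree
at most `|u|`, the coefficient of `x^u` in `M u` is `q^{−n'(u)}`, and `M u`
vanishes at `⟨v⟩` for every `v` with `|v| ≤ |u|`, `v ≠ u`. -/
def IsInterpFamily (q t : ℂ) (M : (Fin n → ℕ) → MvPolynomial (Fin n) ℂ) : Prop :=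
  ∀ u, (M u).totalDegree ≤ wt u ∧
    coeff (Finsupp.equivFunOnFinite.symm u) (M u) = (q ^ nstat' u)⁻¹ ∧
    ∀ v, wt v ≤ wt u → v ≠ u → eval (spec q t v) (M u) = 0

/-- `𝖬_u = q^{n'(u)} t^{n(u)} M_u / c'_u`. -/
def MM (q t : ℂ) (M : (Fin n → ℕ) → MvPolynomial (Fin n) ℂ) (u : Fin n → ℕ) :
    MvPolynomial (Fin n) ℂ :=
  C (q ^ nstat' u * t ^ nstat u / cp q t u) * M u

/-- `𝖤_u = t^{n(u)} E_u / c'_u`, where `E_u` is the homogeneous component of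
degree `|u|` of `M_u`. -/
def EE (q t : ℂ) (M : (Fin n → ℕ) → MvPolynomial (Fin n) ℂ) (u : Fin n → ℕ) :
    MvPolynomial (Fin n) ℂ :=
  C (t ^ nstat u / cp q t u) * homogeneousComponent (wt u) (M u)

/-- The generalized q-binomial coefficient `[u; v] = 𝖬_v(⟨u⟩)/𝖬_v(⟨v⟩)`. -/
def qbin (q t : ℂ) (M : (Fin n → ℕ) → MvPolynomial (Fin n) ℂ) (u v : Fin n → ℕ) : ℂ :=
  eval (spec q t u) (MM q t M v) / eval (spec q t v) (MM q t M v)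

/-- `⟨0⟩/a = (t^{n−1}/a, …, t/a, 1/a)`. -/
def spec0div (q t a : ℂ) : Fin n → ℂ := fun i => spec q t (fun _ => 0) i / a

/-- `cc` is the family of connection coefficients `c_{uv}(a,b)`:
`cc u v = 0` unless `|v| ≤ |u|`, and `𝖬_u(a·x) = Σ_v cc u v · 𝖬_v(b·x)`. -/
def IsConnection (q t : ℂ) (M : (Fin n → ℕ) → MvPolynomial (Fin n) ℂ) (a b : ℂ)
    (cc : (Fin n → ℕ) → (Fin n → ℕ) → ℂ) : Prop :=
  (∀ u v, wt u < wt v → cc u v = 0) ∧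
  ∀ u, aeval (fun i => C a * X i) (MM q t M u) =
    ∑ᶠ v, cc u v • aeval (fun i => C b * X i) (MM q t M v)

/-- `⟦u, v⟧(a, b) = (𝖤_v(⟨0⟩/a)/𝖤_u(⟨0⟩/b)) · c_{uv}(a, b)`. -/
def skew (q t : ℂ) (M : (Fin n → ℕ) → MvPolynomial (Fin n) ℂ) (a b : ℂ)
    (cc : (Fin n → ℕ) → (Fin n → ℕ) → ℂ) (u v : Fin n → ℕ) : ℂ :=
  eval (spec0div q t a) (EE q t M v) / eval (spec0div q t b) (EE q t M u) * cc u v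

/-- `(z; q)_∞ = ∏_{m ≥ 0} (1 − z q^m)`. -/
noncomputable def qpochInf (z q : ℂ) : ℂ := ∏' m : ℕ, (1 - z * q ^ m)

lemma eq_of_generic {q t : ℂ} (hq0 : q ≠ 0) (ht : t ≠ 0)
    (hqt : ∀ i j : ℤ, ¬(i = 0 ∧ j = 0) → q ^ i * t ^ j ≠ 1) {a b c d : ℕ}
    (h : q ^ a * t ^ b = q ^ c * t ^ d) : a = c ∧ b = d := by
  by_contra hne
  refine hqt ((a : ℤ) - c) ((b : ℤ) - d) (by omega) ?_
  rw [zpow_sub₀ hq0, zpow_sub₀ ht]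
  simp only [zpow_natCast]
  field_simp
  exact h

lemma lp_eq_card (u : Fin n → ℕ) (i : Fin n) :
    lp u i = (Finset.univ.filter fun k => u i < u k ∨ (u i = u k ∧ k < i)).card := by
  unfold lp
  rw [← Finset.card_union_of_disjoint]
  · congr 1
    ext k
    simp only [Finset.mem_union, Finset.mem_filter, Finset.mem_univ, true_and]
    rcases lt_trichotomy i k with h | h | h
    · have := h.le
      grind
    · subst h; simp
    · grind
  · rw [Finset.disjoint_filter]
    intro k _ h1 h2
    exact absurd (h1.1.trans h2.1) (lt_irrefl _)

lemma lp_lt (u : Fin n → ℕ) (i : Fin n) : lp u i < n := by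
  rw [lp_eq_card]
  calc _ < (Finset.univ : Finset (Fin n)).card := by
        apply Finset.card_lt_card
        rw [Finset.ssubset_univ_iff]
        intro h
        have := Finset.mem_univ i
        rw [← h] at this
        simp at this
    _ = n := by simp

lemma lp_lt_lp {u : Fin n → ℕ} {i j : Fin n} (h : u j < u i ∨ (u j = u i ∧ i < j)) :
    lp u i < lp u j := by
  rw [lp_eq_card, lp_eq_card]
  apply Finset.card_lt_card
  rw [Finset.ssubset_iff_of_subset]
  · exact ⟨i, by simpa using h, by simp⟩
  · intro k
    simp only [Finset.mem_filter, Finset.mem_univ, true_and]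
    grind

lemma lp_injective (u : Fin n → ℕ) : Function.Injective (lp u) := by
  intro i j h
  by_contra hne
  rcases lt_trichotomy (u i) (u j) with h1 | h1 | h1
  · exact absurd (lp_lt_lp (Or.inl h1)) (by omega)
  · rcases lt_or_gt_of_ne hne with h2 | h2
    · exact absurd (lp_lt_lp (Or.inr ⟨h1.symm, h2⟩)) (by omega)
    · exact absurd (lp_lt_lp (Or.inr ⟨h1, h2⟩)) (by omega)
  · exact absurd (lp_lt_lp (Or.inl h1)) (by omega)

lemma spec_ne_zero {q t : ℂ} (hq0 : q ≠ 0) (ht : t ≠ 0) (u : Fin n → ℕ) (i : Fin n) :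
    spec q t u i ≠ 0 := by
  unfold spec; positivity

lemma spec_injective {q t : ℂ} (hq0 : q ≠ 0) (ht : t ≠ 0)
    (hqt : ∀ i j : ℤ, ¬(i = 0 ∧ j = 0) → q ^ i * t ^ j ≠ 1) (u : Fin n → ℕ) :
    Function.Injective (spec q t u) := by
  intro i j h
  have := (eq_of_generic hq0 ht hqt h).2
  have h1 := lp_lt u i
  have h2 := lp_lt u j
  exact lp_injective u (by omega)

lemma spec_eq_mul_of_eq (q t : ℂ) (u : Fin n → ℕ) {i j : Fin n} (hij : j.val = i.val + 1)
    (h : u i = u j) : spec q t u i = t * spec q t u j := by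
  have hlp : lp u j = lp u i + 1 := by
    rw [lp_eq_card, lp_eq_card]
    rw [← Finset.card_insert_of_notMem (a := i) (by simp)]
    congr 1
    ext k
    simp only [Finset.mem_insert, Finset.mem_filter, Finset.mem_univ, true_and, h, Fin.lt_def,
      Fin.ext_iff]
    grind
  have h1 := lp_lt u j
  unfold spec
  rw [h, show n - 1 - lp u i = n - 1 - lp u j + 1 by omega]
  ring

lemma spec_ne_mul {q t : ℂ} (hq0 : q ≠ 0) (ht : t ≠ 0)
    (hqt : ∀ i j : ℤ, ¬(i = 0 ∧ j = 0) → q ^ i * t ^ j ≠ 1) {u : Fin n → ℕ} {i j : Fin n}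
    (h : u i ≠ u j) : spec q t u i ≠ t * spec q t u j := by
  intro h1
  apply h
  refine (eq_of_generic hq0 ht hqt (b := n - 1 - lp u i) (d := n - 1 - lp u j + 1) ?_).1
  unfold spec at h1
  rw [h1]; ring

lemma lp_comp_of_iff {u v : Fin n → ℕ} (σ : Equiv.Perm (Fin n)) {i : Fin n}
    (h : ∀ k, (v i < v k ∨ (v i = v k ∧ k < i)) ↔
      (u (σ i) < u (σ k) ∨ (u (σ i) = u (σ k) ∧ σ k < σ i))) : lp v i = lp u (σ i) := by
  rw [lp_eq_card, lp_eq_card]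
  exact Finset.card_equiv σ (by simpa using h)

lemma spec_swap (q t : ℂ) {u : Fin n → ℕ} {i j : Fin n} (hij : j.val = i.val + 1)
    (h : u i ≠ u j) : spec q t (u ∘ Equiv.swap i j) = spec q t u ∘ Equiv.swap i j := by
  funext k
  unfold spec
  have hlp : lp (u ∘ Equiv.swap i j) k = lp u (Equiv.swap i j k) := by
    apply lp_comp_of_iff
    intro l
    simp only [Function.comp_apply]
    have : (u (Equiv.swap i j k) = u (Equiv.swap i j l)) →
        (l < k ↔ Equiv.swap i j l < Equiv.swap i j k) := by
      rw [Equiv.swap_apply_def, Equiv.swap_apply_def]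
      simp only [Fin.lt_def, Fin.ext_iff]
      split_ifs <;> grind
    grind
  simp [hlp]

/-- The affine raising map `(v_1, …, v_n) ↦ (v_2, …, v_n, v_1 + 1)`. -/
def raise {m : ℕ} (v : Fin (m + 1) → ℕ) : Fin (m + 1) → ℕ :=
  fun i => v (finRotate (m + 1) i) + if i = Fin.last m then 1 else 0

lemma wt_raise {m : ℕ} (v : Fin (m + 1) → ℕ) : wt (raise v) = wt v + 1 := by
  unfold wt raise
  rw [Finset.sum_add_distrib, Equiv.sum_comp (finRotate (m + 1)) v]
  simp

lemma exists_raise_eq {m : ℕ} (w : Fin (m + 1) → ℕ) (h : w (Fin.last m) ≠ 0) :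
    ∃ v, raise v = w := by
  refine ⟨fun i => w ((finRotate (m + 1)).symm i) -
    if (finRotate (m + 1)).symm i = Fin.last m then 1 else 0, ?_⟩
  funext i
  simp only [raise, Equiv.symm_apply_apply]
  split_ifs with h1
  · subst h1; omega
  · rfl

lemma spec_raise (q t : ℂ) {m : ℕ} (v : Fin (m + 1) → ℕ) (i : Fin (m + 1)) :
    spec q t (raise v) i =
      spec q t v (finRotate (m + 1) i) * if i = Fin.last m then q else 1 := by
  have hlp : lp (raise v) i = lp v (finRotate (m + 1) i) := by
    apply lp_comp_of_iff
    intro k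
    unfold raise
    have key : ∀ l : Fin (m + 1), (l = Fin.last m ∧ (finRotate (m + 1) l).val = 0) ∨
        (l ≠ Fin.last m ∧ l.val < m ∧ (finRotate (m + 1) l).val = l.val + 1) := by
      intro l
      by_cases hl : l = Fin.last m
      · subst hl; simp
      · exact Or.inr ⟨hl, Fin.val_lt_last hl, coe_finRotate_of_ne_last hl⟩
    have hk := key k
    have hi := key i
    have e : k = i ↔ finRotate (m + 1) k = finRotate (m + 1) i := by simp
    simp only [Fin.lt_def]
    rcases hk with ⟨hk, hk'⟩ | ⟨hk, hk2, hk'⟩ <;> rcases hi with ⟨hi, hi'⟩ | ⟨hi, hi2, hi'⟩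
    · simp [hi, hk]
    · have : k.val = m := by simp [hk]
      simp only [hi, hk, if_true, if_false, hi', Fin.val_last]
      rw [hk] at hk'
      omega
    · have : i.val = m := by simp [hi]
      simp only [hi, hk, if_true, if_false, hk', Fin.val_last]
      rw [hi] at hi'
      omega
    · simp only [hi, hk, if_false, hi', hk']
      omega
  unfold spec
  rw [hlp]
  unfold raise
  split_ifs <;> ring

lemma spec_last_of_eq_zero (q t : ℂ) {m : ℕ} {w : Fin (m + 1) → ℕ} (h : w (Fin.last m) = 0) :
    spec q t w (Fin.last m) = 1 := by
  have hlp : lp w (Fin.last m) = m := by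
    rw [lp_eq_card, show (Finset.univ.filter fun k => w (Fin.last m) < w k ∨
      (w (Fin.last m) = w k ∧ k < Fin.last m)) = Finset.univ.erase (Fin.last m) by
        ext k
        simp only [Finset.mem_filter, Finset.mem_univ, true_and, Finset.mem_erase, and_true, h]
        constructor
        · rintro h1 rfl
          simp [h] at h1
        · intro h1
          have := Fin.lt_last_iff_ne_last.mpr h1
          rcases Nat.eq_zero_or_pos (w k) with h2 | h2
          · exact Or.inr ⟨h2.symm, this⟩
          · exact Or.inl h2]
    simp
  simp [spec, hlp, h]

lemma spec_snoc_zero (q t : ℂ) {m : ℕ} (w : Fin m → ℕ) (i : Fin m) :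
    spec q t (Fin.snoc w 0 : Fin (m + 1) → ℕ) i.castSucc = t * spec q t w i := by
  have hlp : lp (Fin.snoc w 0 : Fin (m + 1) → ℕ) i.castSucc = lp w i := by
    rw [lp_eq_card, lp_eq_card]
    refine Eq.trans ?_ (Finset.card_map Fin.castSuccEmb)
    congr 1
    ext k
    refine Fin.lastCases ?_ (fun k => ?_) k
    · simpa using fun _ => Fin.le_last _
    · simp
  have := lp_lt w i
  unfold spec
  rw [hlp, Fin.snoc_castSucc, show m + 1 - 1 - lp w i = m - 1 - lp w i + 1 by omega]
  ring

lemma wt_snoc_zero {m : ℕ} (w : Fin m → ℕ) : wt (Fin.snoc w 0 : Fin (m + 1) → ℕ) = wt w := by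
  simp [wt, Fin.sum_univ_castSucc]

lemma totalDegree_aeval_le {σ τ : Type*} (g : σ → MvPolynomial τ ℂ)
    (hg : ∀ i, (g i).totalDegree ≤ 1) (f : MvPolynomial σ ℂ) :
    (aeval g f).totalDegree ≤ f.totalDegree := by
  rw [aeval_def, eval₂_eq]
  refine totalDegree_finsetSum_le fun d hd => ?_
  refine (totalDegree_mul _ _).trans ?_
  rw [algebraMap_eq, totalDegree_C, zero_add]
  refine (totalDegree_finsetProd _ _).trans (le_trans ?_ (le_totalDegree hd))
  refine Finset.sum_le_sum fun i _ => (totalDegree_pow _ _).trans ?_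
  exact (Nat.mul_le_mul_left _ (hg i)).trans (by simp)

lemma totalDegree_C_mul_X_le {τ : Type*} (c : ℂ) (i : τ) :
    (C c * X i : MvPolynomial τ ℂ).totalDegree ≤ 1 := by
  refine (totalDegree_mul _ _).trans ?_
  simp

lemma totalDegree_C_mul_le {τ : Type*} (c : ℂ) (f : MvPolynomial τ ℂ) :
    (C c * f).totalDegree ≤ f.totalDegree := by
  refine (totalDegree_mul _ _).trans ?_
  simp

lemma aeval_sub_self_mem {σ : Type*} (I : Ideal (MvPolynomial σ ℂ)) (g : σ → MvPolynomial σ ℂ)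
    (hg : ∀ i, g i - X i ∈ I) (f : MvPolynomial σ ℂ) : aeval g f - f ∈ I := by
  rw [← Ideal.Quotient.eq]
  have : ((Ideal.Quotient.mkₐ ℂ I).comp (aeval g)) = Ideal.Quotient.mkₐ ℂ I := by
    apply algHom_ext
    intro i
    simpa using Ideal.Quotient.eq.mpr (hg i)
  exact DFunLike.congr_fun this f

lemma eval_aeval_eq {σ τ : Type*} (g : σ → MvPolynomial τ ℂ) (x : τ → ℂ)
    (f : MvPolynomial σ ℂ) : eval x (aeval g f) = eval (fun i => eval x (g i)) f := by
  induction f using MvPolynomial.induction_on with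
  | C c => simp [algebraMap_eq]
  | add p q hp hq => simp only [map_add, hp, hq]
  | mul_X p i hp => simp only [map_mul, aeval_X, eval_X, hp]

lemma X_sub_C_dvd {σ : Type*} [DecidableEq σ] (i : σ) (c : ℂ) (f : MvPolynomial σ ℂ)
    (hf : ∀ x : σ → ℂ, x i = c → (∀ j ≠ i, x j ≠ 0) → eval x f = 0) : (X i - C c) ∣ f := by
  have h0 : aeval (Function.update X i (C c)) f = (0 : MvPolynomial σ ℂ) := by
    apply MvPolynomial.funext_set (fun _ => ({0}ᶜ : Set ℂ))
      (fun _ => (Set.finite_singleton 0).infinite_compl)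
    intro x hx
    rw [map_zero, eval_aeval_eq]
    refine hf _ (by simp) fun j hj => ?_
    simpa [Function.update_of_ne hj] using hx j (Set.mem_univ j)
  have h := aeval_sub_self_mem (Ideal.span {X i - C c}) (Function.update X i (C c)) (fun j => by
    by_cases hj : j = i
    · subst hj
      rw [Function.update_self, ← Ideal.neg_mem_iff, neg_sub]
      exact Ideal.mem_span_singleton_self _
    · simp [Function.update_of_ne hj]) f
  rw [h0, zero_sub, Ideal.neg_mem_iff] at h
  exact Ideal.mem_span_singleton.mp h

lemma totalDegree_X_sub_C {σ : Type*} (i : σ) (c : ℂ) :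
    (X i - C c : MvPolynomial σ ℂ).totalDegree = 1 := by
  rw [sub_eq_add_neg, totalDegree_add_eq_left_of_totalDegree_lt] <;> simp

lemma totalDegree_le_of_mul {σ : Type*} {p f g : MvPolynomial σ ℂ} {d : ℕ}
    (hp : 1 ≤ p.totalDegree) (h : f = p * g) (hf : f.totalDegree ≤ d + 1) :
    g.totalDegree ≤ d := by
  by_cases hg : g = 0
  · simp [hg]
  · have hp0 : p ≠ 0 := by rintro rfl; simp at hp
    rw [h, totalDegree_mul_of_isDomain hp0 hg] at hf
    omega

lemma one_le_totalDegree_X_sub_X {σ : Type*} {i j : σ} (hij : i ≠ j) :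
    1 ≤ (X i - X j : MvPolynomial σ ℂ).totalDegree := by
  by_contra h
  have h0 : (X i - X j : MvPolynomial σ ℂ).totalDegree = 0 := by omega
  rw [totalDegree_eq_zero_iff_eq_C] at h0
  classical
  have h1 := congrArg (eval fun k => if k = i then (1 : ℂ) else 0) h0
  have h2 := congrArg (eval fun _ => (0 : ℂ)) h0
  simp only [map_sub, eval_X, eval_C, if_true, hij.symm, if_false, sub_zero, sub_self] at h1 h2
  exact one_ne_zero (h1.trans h2.symm)

/-- Existence of the image of a polynomial under a (normalised) Demazure–Lusztig operator. -/
lemma exists_hecke {t : ℂ} (ht : t ≠ 0) {i j : Fin n} (hij : i ≠ j) (f : MvPolynomial (Fin n) ℂ) :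
    ∃ g : MvPolynomial (Fin n) ℂ, g.totalDegree ≤ f.totalDegree ∧
      C t * ((X i - X j) * g) = (X i - C t * X j) * rename (Equiv.swap i j) f +
        C (t - 1) * X i * f := by
  have h : (X i - X j : MvPolynomial (Fin n) ℂ) ∣ (X i - C t * X j) * rename (Equiv.swap i j) f +
        C (t - 1) * X i * f := by
    have h1 := aeval_sub_self_mem (Ideal.span {X i - X j}) (fun k => X (Equiv.swap i j k))
      (fun k => by
        rw [Ideal.mem_span_singleton, Equiv.swap_apply_def]
        split_ifs with h1 h2
        · subst h1; exact ⟨-1, by ring⟩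
        · subst h2; exact ⟨1, by ring⟩
        · simp) f
    rw [Ideal.mem_span_singleton] at h1
    have e : rename (Equiv.swap i j) f = aeval (fun k => X (Equiv.swap i j k)) f := by
      rw [rename_eq_aeval]; rfl
    rw [e]
    have e2 : (X i - C t * X j) * aeval (fun k => X (Equiv.swap i j k)) f + C (t - 1) * X i * f =
      (X i - C t * X j) * (aeval (fun k => X (Equiv.swap i j k)) f - f) +
        (X i - X j) * (C t * f) := by
      rw [C_sub, C_1]; ring
    rw [e2]
    exact dvd_add (h1.mul_left _) (dvd_mul_right _ _)
  obtain ⟨g, hg⟩ := h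
  refine ⟨C t⁻¹ * g, (totalDegree_C_mul_le _ _).trans ?_, ?_⟩
  · refine totalDegree_le_of_mul (one_le_totalDegree_X_sub_X hij) hg ?_
    refine (totalDegree_add _ _).trans (max_le ?_ ?_)
    · refine (totalDegree_mul _ _).trans ?_
      rw [add_comm]
      refine add_le_add (totalDegree_rename_le _ _) ((totalDegree_sub _ _).trans (max_le ?_ ?_))
      · simp
      · exact totalDegree_C_mul_X_le _ _
    · refine (totalDegree_mul _ _).trans ?_
      rw [add_comm]
      exact add_le_add le_rfl (totalDegree_C_mul_X_le _ _)
  · rw [hg]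
    have : (C t * C t⁻¹ : MvPolynomial (Fin n) ℂ) = 1 := by
      rw [← C_mul, mul_inv_cancel₀ ht, C_1]
    linear_combination (X i - X j) * g * this

lemma eval_hecke {t : ℂ} {i j : Fin n} {f g : MvPolynomial (Fin n) ℂ}
    (h : C t * ((X i - X j) * g) = (X i - C t * X j) * rename (Equiv.swap i j) f +
        C (t - 1) * X i * f) (x : Fin n → ℂ) :
    t * ((x i - x j) * eval x g) = (x i - t * x j) * eval (x ∘ Equiv.swap i j) f +
        (t - 1) * x i * eval x f := by
  have := congrArg (eval x) h
  simpa [eval_rename] using this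

/-- The restriction of a polynomial to the line through the origin spanned by `x`. -/
def restrictLine (x : Fin n → ℂ) : MvPolynomial (Fin n) ℂ →ₐ[ℂ] Polynomial ℂ :=
  aeval fun i => Polynomial.C (x i) * Polynomial.X

lemma restrictLine_hecke {t : ℂ} (ht : t ≠ 0) (ht1 : t ≠ 1) {i j : Fin n}
    {f g : MvPolynomial (Fin n) ℂ}
    (h : C t * ((X i - X j) * g) = (X i - C t * X j) * rename (Equiv.swap i j) f +
        C (t - 1) * X i * f) {x : Fin n → ℂ} (hx : x i = t * x j) (hx0 : x j ≠ 0) :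
    restrictLine x g = restrictLine x f := by
  have h1 := congrArg (restrictLine x) h
  have hC : ∀ c : ℂ, restrictLine x (C c) = Polynomial.C c := fun c =>
    (restrictLine x).commutes c
  have hX : ∀ k, restrictLine x (X k) = Polynomial.C (x k) * Polynomial.X := fun k => by
    simp [restrictLine]
  simp only [map_mul, map_sub, map_add, hC, hX, hx] at h1
  have hne : (Polynomial.C (t * (t - 1) * x j) * Polynomial.X : Polynomial ℂ) ≠ 0 := by
    refine mul_ne_zero ?_ Polynomial.X_ne_zero
    rw [Ne, Polynomial.C_eq_zero]
    exact mul_ne_zero (mul_ne_zero ht (sub_ne_zero.mpr ht1)) hx0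
  apply mul_left_cancel₀ hne
  simp only [map_mul, map_sub, map_one] at h1 ⊢
  linear_combination h1

lemma coeff_restrictLine (x : Fin n → ℂ) (d : ℕ) (f : MvPolynomial (Fin n) ℂ) :
    (restrictLine x f).coeff d = eval x (homogeneousComponent d f) := by
  induction f using MvPolynomial.induction_on' with
  | monomial s c =>
    have h : restrictLine x (monomial s c) =
        Polynomial.C (eval x (monomial s c)) * Polynomial.X ^ s.degree := by
      simp only [restrictLine, aeval_monomial, eval_monomial, Finsupp.prod, mul_pow,
        Finset.prod_mul_distrib, Finset.prod_pow_eq_pow_sum, Finsupp.degree_apply, map_mul, map_prod,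
        map_pow, Polynomial.algebraMap_eq]
      ring
    rw [h, Polynomial.coeff_C_mul_X_pow]
    by_cases hd : d = s.degree
    · subst hd
      rw [if_pos rfl, homogeneousComponent_eq_self]
      exact isHomogeneous_monomial _ rfl
    · rw [if_neg hd, homogeneousComponent_of_mem (isHomogeneous_monomial c rfl), if_neg hd,
        map_zero]
  | add p q hp hq => simp [hp, hq]

/-- A polynomial of degree at most `d` is determined by its values at the spectral vectors of the
compositions of weight at most `d`. -/
lemma eq_zero_of_eval_spec {q t : ℂ} (hq0 : q ≠ 0) (ht : t ≠ 0)
    (hqt : ∀ i j : ℤ, ¬(i = 0 ∧ j = 0) → q ^ i * t ^ j ≠ 1) :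
    ∀ (n d : ℕ) (f : MvPolynomial (Fin n) ℂ), f.totalDegree ≤ d →
      (∀ w : Fin n → ℕ, wt w ≤ d → eval (spec q t w) f = 0) → f = 0 := by
  intro n
  induction n with
  | zero =>
    intro d f _ h
    apply MvPolynomial.funext
    intro x
    rw [map_zero, ← h Fin.elim0 (by simp [wt])]
    congr 2
    exact Subsingleton.elim _ _
  | succ m ihm =>
    intro d
    have hdvd : ∀ d (f : MvPolynomial (Fin (m + 1)) ℂ), f.totalDegree ≤ d →
        (∀ w : Fin (m + 1) → ℕ, wt w ≤ d → eval (spec q t w) f = 0) →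
        (X (Fin.last m) - C 1) ∣ f := by
      intro d f hf h
      let g : Fin (m + 1) → MvPolynomial (Fin m) ℂ :=
        Fin.snoc (fun i => C t * X i) (C 1)
      have hg : aeval g f = 0 := by
        apply ihm d
        · refine (totalDegree_aeval_le g (fun i => ?_) f).trans hf
          refine Fin.lastCases ?_ (fun i => ?_) i
          · simp [g]
          · simpa [g] using totalDegree_C_mul_X_le t i
        · intro w hw
          rw [eval_aeval_eq, ← h (Fin.snoc w 0) (by rwa [wt_snoc_zero])]
          congr 2
          funext i
          refine Fin.lastCases ?_ (fun i => ?_) i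
          · rw [spec_last_of_eq_zero q t (by simp)]
            simp [g]
          · rw [spec_snoc_zero]
            simp [g]
      apply X_sub_C_dvd
      intro x hx _
      have h1 := congrArg (eval fun i : Fin m => x i.castSucc / t) hg
      rw [eval_aeval_eq, map_zero] at h1
      rw [← h1]
      congr 2
      funext i
      refine Fin.lastCases ?_ (fun i => ?_) i
      · simp [g, hx]
      · simp only [g, Fin.snoc_castSucc, map_mul, eval_C, eval_X]
        field_simp
    induction d with
    | zero =>
      intro f hf h
      obtain ⟨g, hg⟩ := hdvd 0 f hf h
      by_contra hne
      have hg0 : g ≠ 0 := by rintro rfl; simp [hg] at hne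
      have hp : (X (Fin.last m) - C 1 : MvPolynomial (Fin (m + 1)) ℂ) ≠ 0 := by
        intro h0
        rw [hg, h0, zero_mul] at hne
        exact hne rfl
      rw [hg, totalDegree_mul_of_isDomain hp hg0, totalDegree_X_sub_C] at hf
      omega
    | succ d ihd =>
      intro f hf h
      obtain ⟨g, hg⟩ := hdvd (d + 1) f hf h
      have hgd : g.totalDegree ≤ d := totalDegree_le_of_mul (totalDegree_X_sub_C _ _).ge hg hf
      have hgw : ∀ w : Fin (m + 1) → ℕ, wt w ≤ d → eval (spec q t (raise w)) g = 0 := by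
        intro w hw
        have h1 := h (raise w) (by rw [wt_raise]; omega)
        rw [hg, map_mul] at h1
        refine (mul_eq_zero.mp h1).resolve_left ?_
        simp only [map_sub, eval_X, eval_C]
        intro h2
        have h3 : q ^ (raise w (Fin.last m)) * t ^ (m + 1 - 1 - lp (raise w) (Fin.last m)) =
          q ^ 0 * t ^ 0 := by simpa [spec] using sub_eq_zero.mp h2
        have h4 := (eq_of_generic hq0 ht hqt h3).1
        simp [raise] at h4
      let s : Fin (m + 1) → MvPolynomial (Fin (m + 1)) ℂ :=
        fun i => C (if i = Fin.last m then q else 1) * X (finRotate (m + 1) i)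
      have hs : aeval s g = 0 := by
        apply ihd
        · exact (totalDegree_aeval_le s (fun i => totalDegree_C_mul_X_le _ _) g).trans hgd
        · intro w hw
          rw [eval_aeval_eq, ← hgw w hw]
          congr 2
          funext i
          rw [spec_raise]
          simp [s, mul_comm]
      have hg0 : g = 0 := by
        apply MvPolynomial.funext
        intro x
        have h1 := congrArg (eval fun i => x ((finRotate (m + 1)).symm i) /
          if (finRotate (m + 1)).symm i = Fin.last m then q else 1) hs
        rw [eval_aeval_eq, map_zero] at h1
        rw [map_zero, ← h1]
        congr 2
        funext i
        simp only [s, map_mul, eval_C, eval_X, Equiv.symm_apply_apply]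
        split_ifs <;> field_simp
      rw [hg, hg0, mul_zero]

lemma eval_spec_self_ne_zero {q t : ℂ} (hq0 : q ≠ 0) (ht : t ≠ 0)
    (hqt : ∀ i j : ℤ, ¬(i = 0 ∧ j = 0) → q ^ i * t ^ j ≠ 1)
    {M : (Fin n → ℕ) → MvPolynomial (Fin n) ℂ} (hM : IsInterpFamily q t M)
    (u : Fin n → ℕ) : eval (spec q t u) (M u) ≠ 0 := by
  intro h
  have h0 : M u = 0 := by
    apply eq_zero_of_eval_spec hq0 ht hqt n (wt u) _ (hM u).1
    intro w hw
    by_cases hwu : w = u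
    · rwa [hwu]
    · exact (hM u).2.2 w hw hwu
  have h1 := (hM u).2.1
  rw [h0, coeff_zero] at h1
  exact inv_ne_zero (pow_ne_zero _ hq0) h1.symm

lemma exists_eq_C_mul {q t : ℂ} (hq0 : q ≠ 0) (ht : t ≠ 0)
    (hqt : ∀ i j : ℤ, ¬(i = 0 ∧ j = 0) → q ^ i * t ^ j ≠ 1)
    {M : (Fin n → ℕ) → MvPolynomial (Fin n) ℂ} (hM : IsInterpFamily q t M)
    (u : Fin n → ℕ) (f : MvPolynomial (Fin n) ℂ) (hf : f.totalDegree ≤ wt u)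
    (h : ∀ w, wt w ≤ wt u → w ≠ u → eval (spec q t w) f = 0) : ∃ c, f = C c * M u := by
  have hne := eval_spec_self_ne_zero hq0 ht hqt hM u
  refine ⟨eval (spec q t u) f / eval (spec q t u) (M u), ?_⟩
  rw [← sub_eq_zero]
  apply eq_zero_of_eval_spec hq0 ht hqt n (wt u)
  · exact (totalDegree_sub _ _).trans (max_le hf ((totalDegree_C_mul_le _ _).trans (hM u).1))
  · intro w hw
    by_cases hwu : w = u
    · subst hwu
      simp [hne]
    · simp [h w hw hwu, (hM u).2.2 w hw hwu]

lemma eval_spec_hecke_eq_zero {q t : ℂ} (hq0 : q ≠ 0) (ht : t ≠ 0)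
    (hqt : ∀ i j : ℤ, ¬(i = 0 ∧ j = 0) → q ^ i * t ^ j ≠ 1) {i j : Fin n}
    (hij : j.val = i.val + 1) {f g : MvPolynomial (Fin n) ℂ}
    (h : C t * ((X i - X j) * g) = (X i - C t * X j) * rename (Equiv.swap i j) f +
        C (t - 1) * X i * f) {w : Fin n → ℕ} (hw : eval (spec q t w) f = 0)
    (hsw : w i ≠ w j → eval (spec q t (w ∘ Equiv.swap i j)) f = 0) :
    eval (spec q t w) g = 0 := by
  have h1 := eval_hecke h (spec q t w)
  have h2 : (spec q t w i - t * spec q t w j) *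
      eval (spec q t w ∘ Equiv.swap i j) f = 0 := by
    by_cases hwij : w i = w j
    · rw [spec_eq_mul_of_eq q t w hij hwij, sub_self, zero_mul]
    · rw [← spec_swap q t hij hwij, hsw hwij, mul_zero]
  rw [h2, hw, mul_zero, add_zero] at h1
  have hne : spec q t w i - spec q t w j ≠ 0 :=
    sub_ne_zero.mpr ((spec_injective hq0 ht hqt w).ne (by intro h; subst h; omega))
  simpa [ht, hne] using h1

lemma wt_comp_perm (v : Fin n → ℕ) (σ : Equiv.Perm (Fin n)) : wt (v ∘ σ) = wt v :=
  Equiv.sum_comp σ v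

lemma ne_one_of_generic {q t : ℂ} (hqt : ∀ i j : ℤ, ¬(i = 0 ∧ j = 0) → q ^ i * t ^ j ≠ 1) :
    t ≠ 1 := by
  simpa using hqt 0 1 (by simp)

lemma degree_eq_of_C_mul {p r : Polynomial ℂ} {c : ℂ} {d : ℕ} (h : r = Polynomial.C c * p)
    (hr : r.degree = d) : p.degree = d := by
  have hc : c ≠ 0 := by
    rintro rfl
    simp [h] at hr
  rw [← hr, h, Polynomial.degree_C_mul hc]

lemma restrictLine_C_mul (x : Fin n → ℂ) (c : ℂ) (f : MvPolynomial (Fin n) ℂ) :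
    restrictLine x (C c * f) = Polynomial.C c * restrictLine x f := by
  rw [map_mul]
  congr 1
  exact (restrictLine x).commutes c

lemma degree_restrictLine_swap {q t : ℂ} (hq0 : q ≠ 0) (ht : t ≠ 0)
    (hqt : ∀ i j : ℤ, ¬(i = 0 ∧ j = 0) → q ^ i * t ^ j ≠ 1)
    {M : (Fin n → ℕ) → MvPolynomial (Fin n) ℂ} (hM : IsInterpFamily q t M)
    {x : Fin n → ℂ} {i j : Fin n} (hij : j.val = i.val + 1)
    (hx : x i = t * x j) (hx0 : x j ≠ 0) {v : Fin n → ℕ} (hv : v i ≠ v j)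
    (hdeg : (restrictLine x (M v)).degree = (wt v : ℕ)) :
    (restrictLine x (M (v ∘ Equiv.swap i j))).degree = (wt (v ∘ Equiv.swap i j) : ℕ) := by
  have hne : i ≠ j := by rintro rfl; omega
  obtain ⟨g, hgd, hg⟩ := exists_hecke ht hne (M v)
  have hss : (v ∘ Equiv.swap i j) ∘ Equiv.swap i j = v := by
    funext k; simp
  have hvs : v ∘ Equiv.swap i j ≠ v := by
    intro h
    exact hv (by simpa using (congrFun h j))
  have hs0 : spec q t v i - spec q t v j ≠ 0 :=
    sub_ne_zero.mpr ((spec_injective hq0 ht hqt v).ne hne)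
  set κ : ℂ := (t - 1) * spec q t v i / (t * (spec q t v i - spec q t v j)) with hκ
  have hκ1 : 1 - κ ≠ 0 := by
    have : 1 - κ = (spec q t v i - t * spec q t v j) / (t * (spec q t v i - spec q t v j)) := by
      rw [hκ]; field_simp; ring
    rw [this]
    exact div_ne_zero (sub_ne_zero.mpr (spec_ne_mul hq0 ht hqt hv)) (mul_ne_zero ht hs0)
  have hgv : eval (spec q t v) g = κ * eval (spec q t v) (M v) := by
    have h1 := eval_hecke hg (spec q t v)
    rw [← spec_swap q t hij hv, (hM v).2.2 _ (wt_comp_perm _ _).le hvs] at h1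
    rw [hκ]
    field_simp
    linear_combination h1
  obtain ⟨c, hc⟩ := exists_eq_C_mul hq0 ht hqt hM (v ∘ Equiv.swap i j) (g - C κ * M v) (by
    rw [wt_comp_perm]
    exact (totalDegree_sub _ _).trans
      (max_le (hgd.trans (hM v).1) ((totalDegree_C_mul_le _ _).trans (hM v).1))) (by
    intro w hw hwv
    rw [wt_comp_perm] at hw
    rw [map_sub, map_mul, eval_C]
    by_cases hwv' : w = v
    · subst hwv'; rw [hgv, sub_self]
    · have h0 := (hM v).2.2 w hw hwv'
      rw [h0, mul_zero, sub_zero]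
      refine eval_spec_hecke_eq_zero hq0 ht hqt hij hg h0 fun _ => (hM v).2.2 _ ?_ ?_
      · rwa [wt_comp_perm]
      · rintro rfl
        apply hwv
        funext k; simp)
  have h2 := congrArg (restrictLine x) hc
  rw [map_sub, restrictLine_C_mul, restrictLine_C_mul,
    restrictLine_hecke ht (ne_one_of_generic hqt) hg hx hx0] at h2
  apply degree_eq_of_C_mul h2
  rw [wt_comp_perm, ← hdeg, ← Polynomial.degree_C_mul (p := restrictLine x (M v)) hκ1]
  congr 1
  rw [map_sub, Polynomial.C_1]
  ring

/-- Applying a chain of Demazure–Lusztig operators along the indices `p, …, m - 1`. -/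
lemma exists_hecke_chain {q t : ℂ} (hq0 : q ≠ 0) (ht : t ≠ 0)
    (hqt : ∀ i j : ℤ, ¬(i = 0 ∧ j = 0) → q ^ i * t ^ j ≠ 1) {m d D : ℕ}
    {x : Fin (m + 1) → ℂ} (hx : ∀ i : Fin m, x i.castSucc = t * x i.succ) (hx0 : ∀ i, x i ≠ 0)
    {F : MvPolynomial (Fin (m + 1)) ℂ} (hF : F.totalDegree ≤ D)
    (hF0 : ∀ w, wt w ≤ d → eval (spec q t w) F = 0) (p : Fin (m + 1)) :
    ∃ G : MvPolynomial (Fin (m + 1)) ℂ, G.totalDegree ≤ D ∧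
      (∀ w, wt w ≤ d → eval (spec q t w) G = 0) ∧
      restrictLine x G = restrictLine x F ∧
      ∀ y z : Fin (m + 1) → ℂ, y p = 0 → (∀ j ≠ p, y j ≠ 0) →
        (∀ j : Fin m, j.castSucc < p → z j.castSucc = y j.castSucc) →
        (∀ j : Fin m, p ≤ j.castSucc → z j.castSucc = y j.succ) →
        z (Fin.last m) = 0 → eval y G = eval z F := by
  induction p using Fin.reverseInduction with
  | last =>
    refine ⟨F, hF, hF0, rfl, fun y z hy _ h1 _ h3 => ?_⟩
    congr 2
    funext j
    refine Fin.lastCases ?_ (fun j => ?_) j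
    · rw [hy, h3]
    · rw [h1 j (Fin.castSucc_lt_last j)]
  | cast i ih =>
    obtain ⟨G, hG, hG0, hGx, hGy⟩ := ih
    have hne : i.castSucc ≠ i.succ := (Fin.castSucc_lt_succ).ne
    obtain ⟨g, hgd, hg⟩ := exists_hecke ht hne G
    refine ⟨g, hgd.trans hG, fun w hw => ?_, ?_, fun y z hy hy0 h1 h2 h3 => ?_⟩
    · exact eval_spec_hecke_eq_zero hq0 ht hqt (by simp) hg (hG0 w hw)
        fun _ => hG0 _ (by rwa [wt_comp_perm])
    · rw [restrictLine_hecke ht (ne_one_of_generic hqt) hg (hx i) (hx0 _), hGx]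
    · have h4 := eval_hecke hg y
      have hys := hy0 i.succ hne.symm
      have h5 : eval y g = eval (y ∘ Equiv.swap i.castSucc i.succ) G := by
        rw [hy] at h4
        apply mul_left_cancel₀ (mul_ne_zero ht hys)
        linear_combination -h4
      rw [h5]
      apply hGy _ _ (by simpa using hy) _ _ _ h3
      · intro j hj
        apply hy0
        intro h
        exact hj (by simpa [Equiv.swap_apply_eq_iff] using h)
      · intro j hj
        rcases lt_or_eq_of_le (Fin.castSucc_lt_succ_iff.mp hj) with h | h
        · have := Fin.castSucc_lt_castSucc_iff.mpr h
          rw [h1 j this, Function.comp_apply, Equiv.swap_apply_of_ne_of_ne this.ne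
            (this.trans Fin.castSucc_lt_succ).ne]
        · subst h
          rw [h2 j le_rfl]
          simp
      · intro j hj
        have hij : i < j := Fin.succ_le_castSucc_iff.mp hj
        have a1 : j.succ ≠ i.castSucc := fun h => by
          have := congrArg Fin.val h
          simp only [Fin.val_succ, Fin.val_castSucc] at this
          have := Fin.lt_def.mp hij
          omega
        have a2 : j.succ ≠ i.succ := fun h => hij.ne' (Fin.succ_injective _ h)
        rw [h2 j (Fin.castSucc_le_castSucc_iff.mpr hij.le), Function.comp_apply,
          Equiv.swap_apply_of_ne_of_ne a1 a2]

lemma degree_restrictLine_raise {q t : ℂ} (hq0 : q ≠ 0) (ht : t ≠ 0)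
    (hqt : ∀ i j : ℤ, ¬(i = 0 ∧ j = 0) → q ^ i * t ^ j ≠ 1) {m : ℕ}
    {M : (Fin (m + 1) → ℕ) → MvPolynomial (Fin (m + 1)) ℂ} (hM : IsInterpFamily q t M)
    {x : Fin (m + 1) → ℂ} (hx : ∀ i : Fin m, x i.castSucc = t * x i.succ) (hx0 : ∀ i, x i ≠ 0)
    {v : Fin (m + 1) → ℕ} (hdeg : (restrictLine x (M v)).degree = (wt v : ℕ)) :
    (restrictLine x (M (raise v))).degree = (wt (raise v) : ℕ) := by
  set s : Fin (m + 1) → MvPolynomial (Fin (m + 1)) ℂ :=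
    fun i => C (if i = 0 then q⁻¹ else 1) * X ((finRotate (m + 1)).symm i) with hs
  set F := (X (Fin.last m) - C 1) * aeval s (M v) with hFdef
  have hevF : ∀ y, eval y F = (y (Fin.last m) - 1) *
      eval (fun i => (if i = 0 then q⁻¹ else 1) * y ((finRotate (m + 1)).symm i)) (M v) := by
    intro y
    rw [hFdef, map_mul, eval_aeval_eq]
    simp [hs]
  have hrot : ∀ i, (finRotate (m + 1)).symm i = Fin.last m ↔ i = 0 := by
    intro i
    rw [Equiv.symm_apply_eq, finRotate_last]
  have hFd : F.totalDegree ≤ wt v + 1 := by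
    refine (totalDegree_mul _ _).trans ?_
    rw [totalDegree_X_sub_C, add_comm]
    exact Nat.add_le_add_right
      ((totalDegree_aeval_le s (fun i => totalDegree_C_mul_X_le _ _) _).trans (hM v).1) 1
  have hFw : ∀ w, wt w ≤ wt v + 1 → w ≠ raise v → eval (spec q t w) F = 0 := by
    intro w hw hwv
    rw [hevF]
    by_cases hw0 : w (Fin.last m) = 0
    · rw [spec_last_of_eq_zero q t hw0, sub_self, zero_mul]
    · obtain ⟨w', rfl⟩ := exists_raise_eq w hw0
      rw [wt_raise] at hw
      have h1 := (hM v).2.2 w' (by omega) (by rintro rfl; exact hwv rfl)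
      rw [← mul_zero (spec q t (raise w') (Fin.last m) - 1), ← h1]
      congr 3
      funext i
      rw [spec_raise, Equiv.apply_symm_apply]
      simp only [hrot]
      split_ifs <;> field_simp
  obtain ⟨c, hc⟩ := exists_eq_C_mul hq0 ht hqt hM (raise v) F (by rwa [wt_raise])
    (by rwa [wt_raise])
  obtain ⟨G, hGd, hGw, hGx, hGy⟩ := exists_hecke_chain hq0 ht hqt (d := wt v) hx hx0 hFd
    (fun w hw => hFw w (by omega) (by rintro rfl; rw [wt_raise] at hw; omega)) 0
  have hdvd : (X 0 - C 0) ∣ G + M v := by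
    apply X_sub_C_dvd
    intro y hy hy0
    rw [map_add, hGy y (Fin.snoc (fun j => y j.succ) 0) hy hy0 (by simp) (by simp) (by simp),
      hevF, Fin.snoc_last, zero_sub, neg_one_mul, neg_add_eq_zero]
    congr 2
    funext i
    refine Fin.cases ?_ (fun i => ?_) i
    · simp [(hrot 0).mpr rfl, hy]
    · have : (finRotate (m + 1)).symm i.succ = i.castSucc := by
        rw [Equiv.symm_apply_eq]; simp
      simp [this]
  obtain ⟨h, hh⟩ := hdvd
  have hs0 := spec_ne_zero hq0 ht v 0
  have hhd : h.totalDegree ≤ wt v := by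
    refine totalDegree_le_of_mul (totalDegree_X_sub_C _ _).ge hh ?_
    exact (totalDegree_add _ _).trans (max_le hGd ((hM v).1.trans (Nat.le_succ _)))
  have hheq : h - C (spec q t v 0)⁻¹ * M v = 0 := by
    apply eq_zero_of_eval_spec hq0 ht hqt _ (wt v)
    · exact (totalDegree_sub _ _).trans
        (max_le hhd ((totalDegree_C_mul_le _ _).trans (hM v).1))
    · intro w hw
      have h1 := congrArg (eval (spec q t w)) hh
      rw [map_add, hGw w hw, zero_add, map_mul, C_0, sub_zero, eval_X] at h1
      rw [map_sub, map_mul, eval_C, h1]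
      by_cases hwv : w = v
      · subst hwv; field_simp; ring
      · have h2 := (hM v).2.2 w hw hwv
        rw [h2, zero_eq_mul, or_iff_right (spec_ne_zero hq0 ht w 0)] at h1
        simp [h1]
  rw [sub_eq_zero] at hheq
  have key := congrArg (restrictLine x) hh
  rw [map_add, hGx, hc, hheq, C_0, sub_zero, restrictLine_C_mul, map_mul, restrictLine_C_mul] at key
  have hX : restrictLine x (X 0) = Polynomial.C (x 0) * Polynomial.X := by simp [restrictLine]
  rw [hX] at key
  have key2 : (Polynomial.C (x 0 * (spec q t v 0)⁻¹) * Polynomial.X + Polynomial.C (-1)) *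
      restrictLine x (M v) = Polynomial.C c * restrictLine x (M (raise v)) := by
    rw [map_mul, map_neg, map_one]
    linear_combination -key
  apply degree_eq_of_C_mul key2
  rw [Polynomial.degree_mul, hdeg,
    Polynomial.degree_linear (mul_ne_zero (hx0 0) (inv_ne_zero hs0)), wt_raise, add_comm]
  rfl

lemma degree_restrictLine {q t : ℂ} (hq0 : q ≠ 0) (ht : t ≠ 0)
    (hqt : ∀ i j : ℤ, ¬(i = 0 ∧ j = 0) → q ^ i * t ^ j ≠ 1) {m : ℕ}
    {M : (Fin (m + 1) → ℕ) → MvPolynomial (Fin (m + 1)) ℂ} (hM : IsInterpFamily q t M)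
    {x : Fin (m + 1) → ℂ} (hx : ∀ i : Fin m, x i.castSucc = t * x i.succ) (hx0 : ∀ i, x i ≠ 0)
    (v : Fin (m + 1) → ℕ) : (restrictLine x (M v)).degree = (wt v : ℕ) := by
  obtain ⟨d, hd⟩ : ∃ d, wt v = d := ⟨_, rfl⟩
  induction d generalizing v with
  | zero =>
    have h0 := (hM v).1
    rw [hd, Nat.le_zero, totalDegree_eq_zero_iff_eq_C] at h0
    have h1 := eval_spec_self_ne_zero hq0 ht hqt hM v
    rw [h0, eval_C] at h1
    rw [h0, hd, ← mul_one (C _), restrictLine_C_mul, map_one, mul_one, Polynomial.degree_C h1]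
    rfl
  | succ d ih =>
    have key : ∀ i : Fin (m + 1), ∀ v : Fin (m + 1) → ℕ, wt v = d + 1 → v i ≠ 0 →
        (restrictLine x (M v)).degree = (wt v : ℕ) := by
      intro i
      induction i using Fin.reverseInduction with
      | last =>
        intro v hv hvi
        obtain ⟨v', rfl⟩ := exists_raise_eq v hvi
        rw [wt_raise] at hv
        exact degree_restrictLine_raise hq0 ht hqt hM hx hx0 (ih v' (by omega))
      | cast i ihi =>
        intro v hv hvi
        by_cases h0 : v i.succ = 0
        · have h1 := degree_restrictLine_swap hq0 ht hqt hM (i := i.castSucc) (j := i.succ)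
            (by simp) (hx i) (hx0 _) (v := v ∘ Equiv.swap i.castSucc i.succ)
            (by simpa [h0] using hvi.symm)
            (ihi _ (by rwa [wt_comp_perm]) (by simpa using hvi))
          have hss : (v ∘ Equiv.swap i.castSucc i.succ) ∘ Equiv.swap i.castSucc i.succ = v := by
            funext k; simp
          rwa [hss] at h1
        · exact ihi v hv h0
    obtain ⟨i, hi⟩ : ∃ i, v i ≠ 0 := by
      by_contra! h
      simp [wt, h] at hd
    exact key i v hd hi

lemma cp_ne_zero {q t : ℂ} (hq0 : q ≠ 0) (ht : t ≠ 0)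
    (hqt : ∀ i j : ℤ, ¬(i = 0 ∧ j = 0) → q ^ i * t ^ j ≠ 1) (u : Fin n → ℕ) : cp q t u ≠ 0 := by
  refine Finset.prod_ne_zero_iff.mpr fun i _ => Finset.prod_ne_zero_iff.mpr fun j hj => ?_
  rw [sub_ne_zero]
  intro h
  have h1 : q ^ (u i - j) * t ^ leg u i j = q ^ 0 * t ^ 0 := by rw [← h]; simp
  have := (eq_of_generic hq0 ht hqt h1).1
  rw [Finset.mem_range] at hj
  omega

lemma eval_EE_ne_zero {q t : ℂ} (hq0 : q ≠ 0) (ht : t ≠ 0)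
    (hqt : ∀ i j : ℤ, ¬(i = 0 ∧ j = 0) → q ^ i * t ^ j ≠ 1) (hn : 0 < n)
    {M : (Fin n → ℕ) → MvPolynomial (Fin n) ℂ} (hM : IsInterpFamily q t M)
    {a : ℂ} (ha : a ≠ 0) (v : Fin n → ℕ) : eval (spec0div q t a) (EE q t M v) ≠ 0 := by
  obtain ⟨m, rfl⟩ : ∃ m, n = m + 1 := ⟨n - 1, by omega⟩
  unfold EE
  rw [map_mul, eval_C, ← coeff_restrictLine]
  refine mul_ne_zero (div_ne_zero (pow_ne_zero _ ht) (cp_ne_zero hq0 ht hqt v)) ?_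
  apply Polynomial.coeff_ne_zero_of_eq_degree
  apply degree_restrictLine hq0 ht hqt hM
  · intro i
    unfold spec0div
    rw [spec_eq_mul_of_eq q t (fun _ => 0) (i := i.castSucc) (j := i.succ) (by simp) rfl,
      mul_div_assoc]
  · exact fun i => div_ne_zero (spec_ne_zero hq0 ht _ i) ha

lemma eq_zero_of_sum_MM_eq_zero {q t : ℂ} (hq0 : q ≠ 0) (ht : t ≠ 0)
    (hqt : ∀ i j : ℤ, ¬(i = 0 ∧ j = 0) → q ^ i * t ^ j ≠ 1)
    {M : (Fin n → ℕ) → MvPolynomial (Fin n) ℂ} (hM : IsInterpFamily q t M)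
    {S : Finset (Fin n → ℕ)} {c : (Fin n → ℕ) → ℂ} (h : ∑ v ∈ S, c v • MM q t M v = 0)
    {w : Fin n → ℕ} (hw : w ∈ S) : c w = 0 := by
  obtain ⟨d, hd⟩ : ∃ d, wt w = d := ⟨_, rfl⟩
  induction d using Nat.strong_induction_on generalizing w with
  | _ d ih =>
    have h1 := congrArg (eval (spec q t w)) h
    rw [map_sum, map_zero, Finset.sum_eq_single w] at h1
    · unfold MM at h1
      rw [smul_eval, map_mul, eval_C] at h1
      refine (mul_eq_zero.mp h1).resolve_right (mul_ne_zero (div_ne_zero (mul_ne_zero ?_ ?_) ?_) ?_)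
      · exact pow_ne_zero _ hq0
      · exact pow_ne_zero _ ht
      · exact cp_ne_zero hq0 ht hqt w
      · exact eval_spec_self_ne_zero hq0 ht hqt hM w
    · intro v hv hvw
      rw [smul_eval]
      rcases lt_or_ge (wt v) (wt w) with hlt | hge
      · rw [ih (wt v) (by omega) hv rfl, zero_mul]
      · rw [MM, map_mul, (hM v).2.2 w hge hvw.symm, mul_zero, mul_zero]
    · exact fun h => absurd hw h

/-- Rescaling of all variables. -/
def dilate (r : ℂ) : MvPolynomial (Fin n) ℂ →ₐ[ℂ] MvPolynomial (Fin n) ℂ :=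
  aeval fun i => C r * X i

lemma dilate_dilate (r s : ℂ) (f : MvPolynomial (Fin n) ℂ) :
    dilate r (dilate s f) = dilate (s * r) f := by
  apply MvPolynomial.funext
  intro x
  simp only [dilate, eval_aeval_eq]
  congr 2
  funext i
  simp [mul_assoc]

lemma dilate_one (f : MvPolynomial (Fin n) ℂ) : dilate 1 f = f := by
  simp [dilate]

lemma mem_Icc_of_wt_le {v : Fin n → ℕ} {N : ℕ} (h : wt v ≤ N) :
    v ∈ Finset.Icc (0 : Fin n → ℕ) (fun _ => N) := by
  rw [Finset.mem_Icc]
  exact ⟨fun _ => Nat.zero_le _,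
    fun i => (Finset.single_le_sum (fun _ _ => Nat.zero_le _) (Finset.mem_univ i)).trans h⟩

lemma IsConnection.dilate_eq {q t a b : ℂ} {M : (Fin n → ℕ) → MvPolynomial (Fin n) ℂ}
    {cc : (Fin n → ℕ) → (Fin n → ℕ) → ℂ} (h : IsConnection q t M a b cc) (hb : b ≠ 0)
    {u : Fin n → ℕ} {N : ℕ} (hu : wt u ≤ N) :
    dilate (a * b⁻¹) (MM q t M u) =
      ∑ v ∈ Finset.Icc (0 : Fin n → ℕ) (fun _ => N), cc u v • MM q t M v := by
  have h1 := h.2 u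
  rw [finsum_eq_sum_of_support_subset (s := Finset.Icc (0 : Fin n → ℕ) (fun _ => N))] at h1
  · have h2 : dilate b⁻¹ (dilate a (MM q t M u)) = _ := congrArg (dilate b⁻¹) h1
    rw [dilate_dilate, map_sum] at h2
    rw [h2]
    refine Finset.sum_congr rfl fun v _ => ?_
    rw [map_smul]
    change _ • dilate b⁻¹ (dilate b _) = _
    rw [dilate_dilate, mul_inv_cancel₀ hb, dilate_one]
  · intro v hv
    refine mem_Icc_of_wt_le (le_trans ?_ hu)
    by_contra hlt
    exact hv (by simp [h.1 u v (by omega)])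

/-- **Multiple q-Chu–Vandermonde sum I** (Proposition 6.3). -/
theorem multiple_q_chu_vandermonde_I
    (hn : 0 < n) (q t : ℂ) (hq0 : q ≠ 0) (ht : t ≠ 0)
    (hqt : ∀ i j : ℤ, ¬(i = 0 ∧ j = 0) → q ^ i * t ^ j ≠ 1)
    (M : (Fin n → ℕ) → MvPolynomial (Fin n) ℂ) (hM : IsInterpFamily q t M)
    (a b : ℂ) (ha : a ≠ 0) (hb : b ≠ 0)
    (u w : Fin n → ℕ)
    (ccab cc1a cc1b : (Fin n → ℕ) → (Fin n → ℕ) → ℂ)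
    (h1 : IsConnection q t M a b ccab) (h2 : IsConnection q t M 1 a cc1a)
    (h3 : IsConnection q t M 1 b cc1b) :
    ∑ᶠ v : Fin n → ℕ, skew q t M a b ccab u v * skew q t M 1 a cc1a v w =
      skew q t M 1 b cc1b u w := by
  set S := Finset.Icc (0 : Fin n → ℕ) (fun _ => wt u)
  have hcomp : ∑ z ∈ S, ((∑ v ∈ S, ccab u v * cc1a v z) - cc1b u z) • MM q t M z = 0 := by
    have h4 : dilate (1 * a⁻¹) (dilate (a * b⁻¹) (MM q t M u)) =
        dilate (1 * b⁻¹) (MM q t M u) := by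
      rw [dilate_dilate, show a * b⁻¹ * (1 * a⁻¹) = 1 * b⁻¹ by field_simp]
    rw [h1.dilate_eq hb le_rfl, h3.dilate_eq hb le_rfl, map_sum] at h4
    simp only [sub_smul, Finset.sum_sub_distrib, Finset.sum_smul]
    rw [sub_eq_zero, ← h4, Finset.sum_comm]
    refine Finset.sum_congr rfl fun v _ => ?_
    rw [map_smul]
    rcases le_or_gt (wt v) (wt u) with hv | hv
    · rw [h2.dilate_eq ha hv, Finset.smul_sum]
      exact Finset.sum_congr rfl fun z _ => mul_smul _ _ _
    · simp [h1.1 u v hv]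
  have hsum : ∑ v ∈ S, ccab u v * cc1a v w = cc1b u w := by
    rcases le_or_gt (wt w) (wt u) with hw | hw
    · exact sub_eq_zero.mp
        (eq_zero_of_sum_MM_eq_zero hq0 ht hqt hM hcomp (mem_Icc_of_wt_le hw))
    · rw [h3.1 u w hw]
      refine Finset.sum_eq_zero fun v _ => ?_
      rcases le_or_gt (wt v) (wt u) with hv | hv
      · rw [h2.1 v w (by omega), mul_zero]
      · rw [h1.1 u v hv, zero_mul]
  rw [finsum_eq_sum_of_support_subset (s := S)]
  · unfold skew
    rw [← hsum, Finset.mul_sum]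
    refine Finset.sum_congr rfl fun v _ => ?_
    have hE := eval_EE_ne_zero hq0 ht hqt hn hM ha v
    field_simp
  · intro v hv
    refine mem_Icc_of_wt_le ?_
    by_contra hlt
    exact hv (by simp [skew, h1.1 u v (by omega)])

end LRW
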